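/- Let n ∈ ℕ, I ⊂ ℝ be an interval, M = (M_1,…,M_n) a sequence of n-variable means on I, each symmetric, continuous, and strictly increasing in each variable, and S = (S_1,…,S_m) (m < n) a sequence of symmetric continuous n-variable means on I with (S_1(v),…,S_m(v)) ⊲ (M_1(v),…,M_n(v)) for all v ∈ I^n. Let K : I^n → ℝ be continuous, symmetric, strictly increasing in each variable, and M-invariant, i.e. K(M_1(v),…,M_n(v)) = K(v) for all v ∈ I^n. Then the functional equation K(S_1(v),…,S_m(v), T(v),…,T(v)) = K(v) (with T(v) repeated n−m times, for all v ∈ I^n) possesses exactly one solution T₀ in the family of means, and T₀(v) is the unique solution x of K(S_1(v),…,S_m(v), x,…,x) = K(M_1(v),…,M_n(v)); moreover T₀ is a symmetric continuous n-variable mean on I. -/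

import Mathlib

/-- The nondecreasing rearrangement of a vector. -/
noncomputable def sortAsc {n : ℕ} (v : Fin n → ℝ) : Fin n → ℝ :=
  v ∘ Tuple.sort v

/-- The nonincreasing rearrangement of a vector. -/
noncomputable def sortDesc {n : ℕ} (v : Fin n → ℝ) : Fin n → ℝ :=
  fun k => sortAsc v k.rev

/-- `v ∈ ℝ^m` is ordered majorized by `w ∈ ℝ^n` (`m ≤ n`):
`v↓_k ≤ w↓_k` for all `k ∈ {1,…,m}`. -/
def OrdMaj {m n : ℕ} (h : m ≤ n) (v : Fin m → ℝ) (w : Fin n → ℝ) : Prop :=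
  ∀ k : Fin m, sortDesc v k ≤ sortDesc w (Fin.castLE h k)

/-- `v ∈ ℝ^m` is ordered minorized by `w ∈ ℝ^n` (`m ≤ n`):
`v↑_k ≥ w↑_k` for all `k ∈ {1,…,m}`. -/
def OrdMin {m n : ℕ} (h : m ≤ n) (v : Fin m → ℝ) (w : Fin n → ℝ) : Prop :=
  ∀ k : Fin m, sortAsc w (Fin.castLE h k) ≤ sortAsc v k

/-- `v` is embedded in `w`: it is both ordered majorized and ordered minorized by `w`. -/
def Embedded {m n : ℕ} (h : m ≤ n) (v : Fin m → ℝ) (w : Fin n → ℝ) : Prop :=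
  OrdMaj h v w ∧ OrdMin h v w

/-- The vector `(v_1,…,v_m,x,…,x)` of length `n` (`x` repeated `n - m` times). -/
def padRight {m n : ℕ} (v : Fin m → ℝ) (x : ℝ) : Fin n → ℝ :=
  fun i => if h : (i : ℕ) < m then v ⟨i, h⟩ else x

theorem aux_mono {n : ℕ} {I : Set ℝ} {K : (Fin n → ℝ) → ℝ}
    (hK : ∀ v : Fin n → ℝ, (∀ i, v i ∈ I) → ∀ i : Fin n,
      StrictMonoOn (fun t => K (Function.update v i t)) I)
    (v w : Fin n → ℝ) (hv : ∀ i, v i ∈ I) (hw : ∀ i, w i ∈ I) (h : ∀ i, v i ≤ w i) :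
    K v ≤ K w := by
  classical
  have key : ∀ s : Finset (Fin n), K v ≤ K (s.piecewise w v) := by
    intro s
    induction s using Finset.induction_on with
    | empty => simp
    | insert j s hj ih =>
      have hs : ∀ i, s.piecewise w v i ∈ I := by
        intro i
        by_cases hi : i ∈ s
        · simpa [hi] using hw i
        · simpa [hi] using hv i
      have h1 := (hK _ hs j).monotoneOn (hv j) (hw j) (h j)
      rw [Finset.piecewise_insert]
      refine ih.trans ?_
      have h2 : Function.update (s.piecewise w v) j (v j) = s.piecewise w v := by
        rw [Function.update_eq_self_iff]
        simp [hj]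
      simpa only [h2] using h1
  simpa using key Finset.univ

theorem aux_strict {n : ℕ} {I : Set ℝ} {K : (Fin n → ℝ) → ℝ}
    (hK : ∀ v : Fin n → ℝ, (∀ i, v i ∈ I) → ∀ i : Fin n,
      StrictMonoOn (fun t => K (Function.update v i t)) I)
    (v w : Fin n → ℝ) (hv : ∀ i, v i ∈ I) (hw : ∀ i, w i ∈ I) (h : ∀ i, v i ≤ w i)
    (i : Fin n) (hi : v i < w i) :
    K v < K w := by
  have h1 := hK v hv i (hv i) (hw i) hi
  simp only [Function.update_eq_self] at h1
  refine h1.trans_le (aux_mono hK _ _ ?_ hw ?_)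
  · intro j
    by_cases hj : j = i
    · subst hj; simpa using hw j
    · simpa [hj] using hv j
  · intro j
    by_cases hj : j = i
    · subst hj; simp
    · simpa [hj] using h j

theorem aux_pad_perm {m n : ℕ} (h : m ≤ n) (u : Fin m → ℝ) (x : ℝ) (σ : Equiv.Perm (Fin m)) :
    ∃ τ : Equiv.Perm (Fin n), (padRight (u ∘ σ) x : Fin n → ℝ) = padRight u x ∘ τ := by
  refine ⟨σ.viaFintypeEmbedding (Fin.castLEEmb h), ?_⟩
  funext i
  by_cases hi : (i : ℕ) < m
  · have h1 : i = (Fin.castLEEmb h) ⟨i, hi⟩ := rfl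
    have h2 := σ.viaFintypeEmbedding_apply_image (Fin.castLEEmb h) ⟨i, hi⟩
    rw [← h1] at h2
    simp only [Function.comp, h2]
    simp [padRight, hi]
  · have h2 := σ.viaFintypeEmbedding_apply_notMem_range (f := (Fin.castLEEmb h))
      (b := i) (by
        rintro ⟨j, rfl⟩
        exact hi j.2)
    simp only [Function.comp, h2]
    simp [padRight, hi]

theorem aux_pad_mem {m n : ℕ} {I : Set ℝ} {u : Fin m → ℝ} {x : ℝ} (hu : ∀ j, u j ∈ I)
    (hx : x ∈ I) (i : Fin n) : (padRight u x : Fin n → ℝ) i ∈ I := by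
  unfold padRight
  split_ifs
  · exact hu _
  · exact hx

/-- case of the invariant mean: let `M` be a sequence of `n` symmetric,
continuous `n`-variable means on `I`, each strictly increasing in each variable,
`S ∈ E(M)` with `|S| = m < n`, and let `K ∈ CS_n(I)` be an `M`-invariant mean. Then
the equation `K(S_1(v),…,S_m(v),T(v),…,T(v)) = K(v)` has exactly one solution `T₀` in
the family of means; moreover `T₀ = 𝒯_{S,M}(K)` (i.e. `T₀(v)` is the unique solution
`x` of `K(S_1(v),…,S_m(v),x,…,x) = K(M_1(v),…,M_n(v))`) and `T₀` is a symmetric,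
continuous `n`-variable mean on `I`. -/
theorem invariant_mean_complementary (n m : ℕ) (hmn : m < n)
    (I : Set ℝ) (hI : I.OrdConnected)
    (M : Fin n → (Fin n → ℝ) → ℝ)
    (hMmean : ∀ j v, (∀ i, v i ∈ I) → (⨅ i, v i) ≤ M j v ∧ M j v ≤ (⨆ i, v i))
    (hMsym : ∀ j v, (∀ i, v i ∈ I) → ∀ σ : Equiv.Perm (Fin n), M j (v ∘ σ) = M j v)
    (hMcont : ∀ j, ContinuousOn (M j) {v : Fin n → ℝ | ∀ i, v i ∈ I})
    (hMmono : ∀ j, ∀ v : Fin n → ℝ, (∀ i, v i ∈ I) → ∀ i : Fin n,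
      StrictMonoOn (fun t => M j (Function.update v i t)) I)
    (S : Fin m → (Fin n → ℝ) → ℝ)
    (hSmean : ∀ j v, (∀ i, v i ∈ I) → (⨅ i, v i) ≤ S j v ∧ S j v ≤ (⨆ i, v i))
    (hSsym : ∀ j v, (∀ i, v i ∈ I) → ∀ σ : Equiv.Perm (Fin n), S j (v ∘ σ) = S j v)
    (hScont : ∀ j, ContinuousOn (S j) {v : Fin n → ℝ | ∀ i, v i ∈ I})
    (hSM : ∀ v : Fin n → ℝ, (∀ i, v i ∈ I) →
      Embedded hmn.le (fun j => S j v) (fun j => M j v))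
    (K : (Fin n → ℝ) → ℝ)
    (hKmean : ∀ v : Fin n → ℝ, (∀ i, v i ∈ I) → (⨅ i, v i) ≤ K v ∧ K v ≤ (⨆ i, v i))
    (hKcont : ContinuousOn K {v : Fin n → ℝ | ∀ i, v i ∈ I})
    (hKsym : ∀ v : Fin n → ℝ, (∀ i, v i ∈ I) → ∀ σ : Equiv.Perm (Fin n), K (v ∘ σ) = K v)
    (hKmono : ∀ v : Fin n → ℝ, (∀ i, v i ∈ I) → ∀ i : Fin n,
      StrictMonoOn (fun t => K (Function.update v i t)) I)
    (hKinv : ∀ v : Fin n → ℝ, (∀ i, v i ∈ I) → K (fun j => M j v) = K v) :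
    ∃ T₀ : (Fin n → ℝ) → ℝ,
      (∀ v : Fin n → ℝ, (∀ i, v i ∈ I) → (⨅ i, v i) ≤ T₀ v ∧ T₀ v ≤ (⨆ i, v i)) ∧
      (∀ v : Fin n → ℝ, (∀ i, v i ∈ I) →
        K (padRight (fun j => S j v) (T₀ v)) = K v) ∧
      (∀ v : Fin n → ℝ, (∀ i, v i ∈ I) →
        K (padRight (fun j => S j v) (T₀ v)) = K (fun j => M j v) ∧
        ∀ x : ℝ, x ∈ I → K (padRight (fun j => S j v) x) = K (fun j => M j v) → x = T₀ v) ∧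
      (∀ v : Fin n → ℝ, (∀ i, v i ∈ I) → ∀ σ : Equiv.Perm (Fin n), T₀ (v ∘ σ) = T₀ v) ∧
      ContinuousOn T₀ {v : Fin n → ℝ | ∀ i, v i ∈ I} ∧
      ∀ T : (Fin n → ℝ) → ℝ,
        (∀ v : Fin n → ℝ, (∀ i, v i ∈ I) → (⨅ i, v i) ≤ T v ∧ T v ≤ (⨆ i, v i)) →
        (∀ v : Fin n → ℝ, (∀ i, v i ∈ I) →
          K (padRight (fun j => S j v) (T v)) = K v) →
        ∀ v : Fin n → ℝ, (∀ i, v i ∈ I) → T v = T₀ v := by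
  classical
  have hn : 0 < n := by omega
  have : Nonempty (Fin n) := ⟨⟨0, hn⟩⟩
  have hinf : ∀ v : Fin n → ℝ, (∀ i, v i ∈ I) → (⨅ i, v i) ∈ I := by
    intro v hv
    obtain ⟨i, hi⟩ := exists_eq_ciInf_of_finite (f := v)
    rw [← hi]; exact hv i
  have hsup : ∀ v : Fin n → ℝ, (∀ i, v i ∈ I) → (⨆ i, v i) ∈ I := by
    intro v hv
    obtain ⟨i, hi⟩ := exists_eq_ciSup_of_finite (f := v)
    rw [← hi]; exact hv i
  have hmem : ∀ v : Fin n → ℝ, (∀ i, v i ∈ I) → ∀ x, (⨅ i, v i) ≤ x ∧ x ≤ (⨆ i, v i) → x ∈ I :=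
    fun v hv x hx => hI.out (hinf v hv) (hsup v hv) hx
  have hSI : ∀ v : Fin n → ℝ, (∀ i, v i ∈ I) → ∀ j, S j v ∈ I :=
    fun v hv j => hmem v hv _ (hSmean j v hv)
  have hMI : ∀ v : Fin n → ℝ, (∀ i, v i ∈ I) → ∀ j, M j v ∈ I :=
    fun v hv j => hmem v hv _ (hMmean j v hv)
  have hstr : ∀ u : Fin m → ℝ, (∀ j, u j ∈ I) →
      StrictMonoOn (fun x => K (padRight u x)) I := by
    intro u hu x hx y hy hxy
    refine aux_strict hKmono _ _ (aux_pad_mem hu hx) (aux_pad_mem hu hy) ?_ ⟨m, hmn⟩ ?_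
    · intro i
      unfold padRight
      split_ifs
      · exact le_rfl
      · exact hxy.le
    · simpa [padRight] using hxy
  have hpadperm : ∀ u : Fin m → ℝ, (∀ j, u j ∈ I) → ∀ x ∈ I, ∀ σ : Equiv.Perm (Fin m),
      K (padRight (u ∘ σ) x) = K (padRight u x) := by
    intro u hu x hx σ
    obtain ⟨τ, hτ⟩ := aux_pad_perm hmn.le u x σ
    rw [hτ, hKsym _ (aux_pad_mem hu hx)]
  have hupper : ∀ v : Fin n → ℝ, (∀ i, v i ∈ I) →
      K (fun j => M j v) ≤ K (padRight (fun j => S j v) (⨆ i, v i)) := by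
    intro v hv
    rw [← hKsym _ (hMI v hv) (Tuple.sort (fun j => M j v)),
      ← hpadperm _ (hSI v hv) _ (hsup v hv) (Tuple.sort (fun j => S j v))]
    refine aux_mono hKmono _ _ (fun i => hMI v hv _)
      (aux_pad_mem (fun j => hSI v hv _) (hsup v hv)) ?_
    intro i
    unfold padRight
    split_ifs with h
    · exact (hSM v hv).2 ⟨i, h⟩
    · exact (hMmean _ v hv).2
  have hlower : ∀ v : Fin n → ℝ, (∀ i, v i ∈ I) →
      K (padRight (fun j => S j v) (⨅ i, v i)) ≤ K (fun j => M j v) := by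
    intro v hv
    rw [← hKsym _ (hMI v hv) (Fin.revPerm.trans (Tuple.sort (fun j => M j v))),
      ← hpadperm _ (hSI v hv) _ (hinf v hv) (Fin.revPerm.trans (Tuple.sort (fun j => S j v)))]
    refine aux_mono hKmono _ _
      (aux_pad_mem (fun j => hSI v hv _) (hinf v hv)) (fun i => hMI v hv _) ?_
    intro i
    unfold padRight
    split_ifs with h
    · exact (hSM v hv).1 ⟨i, h⟩
    · exact (hMmean _ v hv).1
  have hex : ∀ v : Fin n → ℝ, ∃ x : ℝ, (∀ i, v i ∈ I) →
      ((⨅ i, v i) ≤ x ∧ x ≤ (⨆ i, v i)) ∧ K (padRight (fun j => S j v) x) = K v := by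
    intro v
    by_cases hv : ∀ i, v i ∈ I
    · have hle : (⨅ i, v i) ≤ ⨆ i, v i := (hKmean v hv).1.trans (hKmean v hv).2
      have hc : ContinuousOn (fun x => K (padRight (fun j => S j v) x))
          (Set.Icc (⨅ i, v i) (⨆ i, v i)) := by
        refine hKcont.comp (Continuous.continuousOn ?_)
          (fun x hx => aux_pad_mem (hSI v hv) (hmem v hv x hx))
        refine continuous_pi fun i => ?_
        unfold padRight
        split_ifs
        · exact continuous_const
        · exact continuous_id
      have h1 := hlower v hv
      have h2 := hupper v hv
      rw [hKinv v hv] at h1 h2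
      obtain ⟨x, hx, hxe⟩ := intermediate_value_Icc hle hc ⟨h1, h2⟩
      exact ⟨x, fun _ => ⟨hx, hxe⟩⟩
    · exact ⟨0, fun h => absurd h hv⟩
  choose T hT using hex
  have hTI : ∀ v : Fin n → ℝ, (∀ i, v i ∈ I) → T v ∈ I :=
    fun v hv => hmem v hv _ (hT v hv).1
  have huniq : ∀ v : Fin n → ℝ, (∀ i, v i ∈ I) → ∀ x ∈ I,
      K (padRight (fun j => S j v) x) = K v → x = T v := by
    intro v hv x hx h
    exact (hstr _ (hSI v hv)).injOn hx (hTI v hv) (h.trans (hT v hv).2.symm)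
  have hFc : ∀ y ∈ I, ContinuousOn (fun v => K (padRight (fun j => S j v) y))
      {v : Fin n → ℝ | ∀ i, v i ∈ I} := by
    intro y hy
    refine hKcont.comp (f := fun v => (padRight (fun j => S j v) y : Fin n → ℝ)) ?_
      (fun v hv => aux_pad_mem (hSI v hv) hy)
    refine continuousOn_pi.2 fun i => ?_
    unfold padRight
    split_ifs
    · exact hScont _
    · exact continuousOn_const
  refine ⟨T, fun v hv => (hT v hv).1, fun v hv => (hT v hv).2, ?_, ?_, ?_, ?_⟩
  · intro v hv
    rw [hKinv v hv]
    exact ⟨(hT v hv).2, huniq v hv⟩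
  · intro v hv σ
    have hvσ : ∀ i, (v ∘ σ) i ∈ I := fun i => hv _
    refine huniq v hv _ (hTI _ hvσ) ?_
    have h := (hT _ hvσ).2
    rw [hKsym v hv] at h
    simpa only [hSsym _ v hv σ] using h
  · intro v₀ hv₀
    refine tendsto_order.2 ⟨fun y hy => ?_, fun y hy => ?_⟩
    · by_cases hyI : y ∈ I
      · have h0 := hstr _ (hSI v₀ hv₀) hyI (hTI v₀ hv₀) hy
        simp only [(hT v₀ hv₀).2] at h0
        filter_upwards [(hFc y hyI v₀ hv₀).eventually_lt (hKcont v₀ hv₀) h0,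
          self_mem_nhdsWithin] with v h1 hv
        rw [← (hT v hv).2] at h1
        exact ((hstr _ (hSI v hv)).lt_iff_lt hyI (hTI v hv)).1 h1
      · filter_upwards [self_mem_nhdsWithin] with v hv
        by_contra hc
        exact hyI (hI.out (hTI v hv) (hTI v₀ hv₀) ⟨not_lt.1 hc, hy.le⟩)
    · by_cases hyI : y ∈ I
      · have h0 := hstr _ (hSI v₀ hv₀) (hTI v₀ hv₀) hyI hy
        simp only [(hT v₀ hv₀).2] at h0
        filter_upwards [(hKcont v₀ hv₀).eventually_lt (hFc y hyI v₀ hv₀) h0,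
          self_mem_nhdsWithin] with v h1 hv
        rw [← (hT v hv).2] at h1
        exact ((hstr _ (hSI v hv)).lt_iff_lt (hTI v hv) hyI).1 h1
      · filter_upwards [self_mem_nhdsWithin] with v hv
        by_contra hc
        exact hyI (hI.out (hTI v₀ hv₀) (hTI v hv) ⟨hy.le, not_lt.1 hc⟩)
  · intro T' hT' hT'e v hv
    exact huniq v hv _ (hmem v hv _ (hT' v hv)) (hT'e v hv)
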